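/- Let {P_n}_{n≥0} be a sequence of monic orthogonal polynomials for W_L, and let 𝔇 be a differential operator with matrix polynomial coefficients F_0, …, F_n ∈ Mat_N(ℂ[x]) with F_n ≠ 0, such that for every k ≥ 0 there exists Λ_k ∈ Mat_N(ℂ) with P_k·𝔇 = Λ_k P_k. Then the order n is even, say n = 2m, and the leading coefficient satisfies F_n(x) = c x^m I for some c ∈ ℂ. -/

import Mathlib

open Polynomial MeasureTheory Matrix

noncomputable section

abbrev Mat (N : ℕ) := Matrix (Fin N) (Fin N) ℂ

/-- The matrix unit with a `1` in the (1-indexed) entry `(s, t)` and `0` elsewhere. -/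
def EU (N : ℕ) (s t : ℕ) : Mat N :=
  Matrix.of fun p q => if (p : ℕ) + 1 = s ∧ (q : ℕ) + 1 = t then 1 else 0

/-- Evaluation of a matrix polynomial at a real point. -/
def mval {N : ℕ} (P : Polynomial (Mat N)) (x : ℝ) : Mat N :=
  Polynomial.eval ((x : ℂ) • (1 : Mat N)) P

/-- The nilpotent matrix `A = Σ a_{2j-1} E_{2j-1,2j} + Σ a_{2j} E_{2j+1,2j}`. -/
def Amat (N : ℕ) (a : ℕ → ℝ) : Mat N :=
  (∑ j ∈ Finset.Icc 1 (N / 2), (a (2 * j - 1) : ℂ) • EU N (2 * j - 1) (2 * j)) +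
  (∑ j ∈ Finset.Icc 1 ((N - 1) / 2), (a (2 * j) : ℂ) • EU N (2 * j + 1) (2 * j))

/-- `K = Σ_{j=1}^{⌊N/2⌋} E_{2j,2j}`. -/
def Kmat (N : ℕ) : Mat N := ∑ j ∈ Finset.Icc 1 (N / 2), EU N (2 * j) (2 * j)

/-- `T(x) = I + x A`. -/
def Tmat (N : ℕ) (a : ℕ → ℝ) (x : ℝ) : Mat N := 1 + (x : ℂ) • Amat N a

/-- The diagonal Laguerre weight `diag(e^{-x}x^{α₁}, …, e^{-x}x^{α_N})` (1-indexed `α`). -/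
def laguerreDiag (N : ℕ) (α : ℕ → ℝ) (x : ℝ) : Mat N :=
  Matrix.diagonal fun i => ((Real.exp (-x) * x ^ α ((i : ℕ) + 1) : ℝ) : ℂ)

/-- The Laguerre-type weight `W_L(x) = T(x) · diag(…) · T(x)^*`. -/
def WL (N : ℕ) (a α : ℕ → ℝ) (x : ℝ) : Mat N :=
  Tmat N a x * laguerreDiag N α x * (Tmat N a x)ᴴ

/-- The right action `P·𝔇 = Σ_{j=0}^n P^{(j)} F_j` of a differential operator with
matrix-polynomial coefficients `F_0, …, F_n`. -/
def applyOp {N : ℕ} (F : ℕ → Polynomial (Mat N)) (n : ℕ) (P : Polynomial (Mat N)) :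
    Polynomial (Mat N) :=
  ∑ j ∈ Finset.range (n + 1), (fun Q : Polynomial (Mat N) => derivative Q)^[j] P * F j

/-- The roots of `Q₁`, `Q₂` modulo shifts force `a - b` to be an integer. -/
theorem exists_int_of_shift_eq {Q₁ Q₂ : ℂ[X]} (h₁ : Q₁ ≠ 0) (h₂ : Q₂ ≠ 0) {a b : ℂ}
    (h : taylor 1 Q₁ * (X + C a) * Q₂ = taylor 1 Q₂ * (X + C b) * Q₁) :
    ∃ k : ℤ, a - b = k := by
  have ht : ∀ Q : ℂ[X], (taylor 1 Q).roots = Q.roots.map fun x => x - 1 := fun Q => by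
    have := roots_comp_C_mul_X_add_C Q (1 : ℂ) 1 isUnit_one
    simpa [taylor_apply] using this
  have hs : ∀ Q : ℂ[X], (taylor 1 Q).roots.sum = Q.roots.sum - Q.roots.card := fun Q => by
    rw [ht, Multiset.sum_map_sub]; simp
  have hx : ∀ c : ℂ, (X + C c : ℂ[X]) ≠ 0 := fun c => X_add_C_ne_zero c
  have key : ∀ {Q Q' : ℂ[X]} (c : ℂ), Q ≠ 0 → Q' ≠ 0 →
      (taylor 1 Q * (X + C c) * Q').roots.sum =
        Q.roots.sum - Q.roots.card - c + Q'.roots.sum := fun {Q Q'} c hQ hQ' => by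
    have hQt : taylor 1 Q ≠ 0 := by rwa [Ne, taylor_eq_zero]
    rw [roots_mul (mul_ne_zero (mul_ne_zero hQt (hx c)) hQ'), roots_mul (mul_ne_zero hQt (hx c)),
      roots_X_add_C, Multiset.sum_add, Multiset.sum_add, hs, Multiset.sum_singleton]
    ring
  have := key a h₁ h₂
  rw [h, key b h₂ h₁] at this
  exact ⟨Q₂.roots.card - Q₁.roots.card, by push_cast; linear_combination this⟩

/-- A polynomial vanishing at every natural number is zero. -/
theorem eq_zero_of_eval_natCast {Q : ℂ[X]} (h : ∀ k : ℕ, Q.eval (k : ℂ) = 0) : Q = 0 :=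
  eq_zero_of_infinite_isRoot Q <|
    (Set.infinite_range_of_injective (Nat.cast_injective (R := ℂ))).mono <| by
      rintro _ ⟨k, rfl⟩; exact h k

/-- The moments of `L` satisfy the recursion of the moments of the Laguerre weight `e^{-x} x^α`. -/
structure IsLaguerre (α : ℝ) (L : ℂ[X] →ₗ[ℂ] ℂ) : Prop where
  gt : -1 < α
  one : L 1 ≠ 0
  succ : ∀ k : ℕ, L (X ^ (k + 1)) = (k + α + 1) * L (X ^ k)

namespace IsLaguerre

variable {α : ℝ} {L : ℂ[X] →ₗ[ℂ] ℂ}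

theorem add_ne_zero (hL : IsLaguerre α L) (k : ℕ) : (k + α + 1 : ℂ) ≠ 0 := by
  have : (0 : ℝ) < k + α + 1 := by linarith [hL.gt, k.cast_nonneg (α := ℝ)]
  exact_mod_cast this.ne'

theorem pow_ne_zero (hL : IsLaguerre α L) (k : ℕ) : L (X ^ k) ≠ 0 := by
  induction k with
  | zero => simpa using hL.one
  | succ k ih => rw [hL.succ]; exact mul_ne_zero (hL.add_ne_zero k) ih

theorem exists_moment (hL : IsLaguerre α L) (u : ℂ[X]) :
    ∃ Q : ℂ[X], (Q = 0 → u = 0) ∧ ∀ k : ℕ, L (X ^ k * u) = Q.eval (k : ℂ) * L (X ^ k) := by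
  induction hd : u.natDegree using Nat.strong_induction_on generalizing u with
  | _ d ih =>
  by_cases h0 : u.natDegree = 0
  · obtain ⟨c, rfl⟩ := natDegree_eq_zero.mp h0
    exact ⟨C c, id, fun k => by rw [mul_comm, ← smul_eq_C_mul, map_smul]; simp⟩
  · obtain ⟨Q, hQ, hQL⟩ := ih u.divX.natDegree
      (by rw [natDegree_divX_eq_natDegree_tsub_one]; omega) u.divX rfl
    refine ⟨(X + C (α + 1 : ℂ)) * taylor 1 Q + C (u.coeff 0), fun hz => ?_, fun k => ?_⟩
    · have h1 : u.coeff 0 = 0 := by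
        have := congrArg (eval (-(α + 1 : ℂ))) hz
        simpa using this
      rw [h1, C_0, add_zero, mul_eq_zero, taylor_eq_zero] at hz
      have h2 := hQ (hz.resolve_left (X_add_C_ne_zero _))
      rw [← divX_mul_X_add u, h1, h2]; simp
    · have : X ^ k * u = X ^ (k + 1) * u.divX + u.coeff 0 • X ^ k := by
        conv_lhs => rw [← divX_mul_X_add u]
        rw [smul_eq_C_mul]; ring
      rw [this, map_add, map_smul, hQL, hL.succ]
      simp [taylor_eval]
      ring

theorem eq_zero (hL : IsLaguerre α L) {u : ℂ[X]} {K : ℕ} (h : ∀ k : ℕ, L (u * X ^ (K + k)) = 0) :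
    u = 0 := by
  obtain ⟨Q, hQ, hQL⟩ := hL.exists_moment (X ^ K * u)
  have : Q = 0 := eq_zero_of_eval_natCast fun k => by
    have h1 := hQL k
    rw [show X ^ k * (X ^ K * u) = u * X ^ (K + k) by ring, h k] at h1
    exact (mul_eq_zero.mp h1.symm).resolve_right (hL.pow_ne_zero k)
  simpa using hQ this

theorem eq_zero_of_forall (hL : IsLaguerre α L) {u : ℂ[X]} (h : ∀ g, L (u * g) = 0) : u = 0 :=
  hL.eq_zero (K := 0) fun _ => h _

theorem moments_incompatible (hL : IsLaguerre α L) {α' : ℝ} {L' : ℂ[X] →ₗ[ℂ] ℂ}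
    (hL' : IsLaguerre α' L') (hint : ¬ ∃ k : ℤ, α - α' = (k : ℝ)) {Q Q' : ℂ[X]}
    (h : ∀ k : ℕ, Q.eval (k : ℂ) * L (X ^ k) = Q'.eval (k : ℂ) * L' (X ^ k)) : Q = 0 := by
  by_contra hQ
  by_cases hQ' : Q' = 0
  · refine hQ (eq_zero_of_eval_natCast fun k => ?_)
    have := h k
    rw [hQ', eval_zero, zero_mul] at this
    exact (mul_eq_zero.mp this).resolve_right (hL.pow_ne_zero k)
  have key : taylor 1 Q * (X + C (α + 1 : ℂ)) * Q' = taylor 1 Q' * (X + C (α' + 1 : ℂ)) * Q := by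
    refine sub_eq_zero.mp (eq_zero_of_eval_natCast fun k => ?_)
    have h0 := h k
    have h1 := h (k + 1)
    rw [hL.succ, hL'.succ] at h1
    push_cast at h1
    refine (mul_eq_zero.mp (?_ : _ * (L (X ^ k) * L' (X ^ k)) = 0)).resolve_right
      (mul_ne_zero (hL.pow_ne_zero k) (hL'.pow_ne_zero k))
    simp only [eval_sub, eval_mul, taylor_eval, eval_add, eval_X, eval_C]
    linear_combination (L' (X ^ k) * eval (k : ℂ) Q') * h1 -
      (eval (k + 1 : ℂ) Q' * (k + α' + 1) * L' (X ^ k)) * h0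
  obtain ⟨k, hk⟩ := exists_int_of_shift_eq hQ hQ' key
  refine hint ⟨k, ?_⟩
  have : ((α - α' : ℝ) : ℂ) = ((k : ℝ) : ℂ) := by push_cast; linear_combination hk
  exact_mod_cast this

end IsLaguerre

section Symbol

/-- Multiplication by a polynomial, as an operator on `ℂ[X]`. -/
abbrev mulOp (p : ℂ[X]) : Module.End ℂ ℂ[X] := LinearMap.mulLeft ℂ p

/-- Differentiation, as an operator on `ℂ[X]`. -/
abbrev derivOp : Module.End ℂ ℂ[X] := derivative

/-- The commutator with multiplication by `X`. -/
def adX (φ : Module.End ℂ ℂ[X]) : Module.End ℂ ℂ[X] := φ * mulOp X - mulOp X * φ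

/-- `φ` is a differential operator of order at most `n` whose coefficient of order `n` is `s`. -/
def HasSymbol : ℕ → ℂ[X] → Module.End ℂ ℂ[X] → Prop
  | 0, s, φ => φ = mulOp s
  | n + 1, s, φ => HasSymbol n ((n + 1 : ℂ) • s) (adX φ)

theorem derivOp_mulOp_X : derivOp * mulOp X = mulOp X * derivOp + 1 := by
  refine LinearMap.ext fun p => ?_; simp [add_comm]

theorem mulOp_commute (p q : ℂ[X]) : mulOp p * mulOp q = mulOp q * mulOp p := by
  refine LinearMap.ext fun f => ?_; simp [mul_left_comm]

namespace HasSymbol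

theorem add {n : ℕ} {s t : ℂ[X]} {φ ψ : Module.End ℂ ℂ[X]} (hφ : HasSymbol n s φ)
    (hψ : HasSymbol n t ψ) : HasSymbol n (s + t) (φ + ψ) := by
  induction n generalizing s t φ ψ with
  | zero =>
    rw [HasSymbol] at *
    rw [hφ, hψ]; refine LinearMap.ext fun f => ?_; simp [add_mul]
  | succ n ih =>
    rw [HasSymbol] at *
    have := ih hφ hψ
    rw [← smul_add] at this
    convert this using 1
    simp only [adX]; noncomm_ring

theorem smul {n : ℕ} {s : ℂ[X]} {φ : Module.End ℂ ℂ[X]} (c : ℂ) (hφ : HasSymbol n s φ) :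
    HasSymbol n (c • s) (c • φ) := by
  induction n generalizing s φ with
  | zero => rw [HasSymbol] at *; rw [hφ]; refine LinearMap.ext fun f => ?_; simp
  | succ n ih =>
    rw [HasSymbol] at *
    have := ih hφ
    rw [smul_comm] at this
    convert this using 1
    simp only [adX, smul_sub, smul_mul_assoc, mul_smul_comm]

theorem zero (n : ℕ) : HasSymbol n 0 0 := by
  induction n with
  | zero => rw [HasSymbol]; refine LinearMap.ext fun f => ?_; simp
  | succ n ih => rw [HasSymbol]; simpa [adX] using ih

theorem sum {ι : Type*} {S : Finset ι} {n : ℕ} {s : ι → ℂ[X]} {φ : ι → Module.End ℂ ℂ[X]}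
    (h : ∀ i ∈ S, HasSymbol n (s i) (φ i)) : HasSymbol n (∑ i ∈ S, s i) (∑ i ∈ S, φ i) := by
  classical
  induction S using Finset.induction_on with
  | empty => simpa using zero n
  | insert i S hi ih =>
    rw [Finset.sum_insert hi, Finset.sum_insert hi]
    exact (h i (by simp)).add (ih fun j hj => h j (by simp [hj]))

theorem mulOp_mul {n : ℕ} {s : ℂ[X]} {φ : Module.End ℂ ℂ[X]} (p : ℂ[X]) (hφ : HasSymbol n s φ) :
    HasSymbol n (p * s) (mulOp p * φ) := by
  induction n generalizing s φ with
  | zero => rw [HasSymbol] at *; rw [hφ]; refine LinearMap.ext fun f => ?_; simp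
  | succ n ih =>
    rw [HasSymbol] at *
    have := ih hφ
    rw [mul_smul_comm] at this
    convert this using 1
    simp only [adX, mul_sub, ← mul_assoc, mulOp_commute p X]

theorem mul_mulOp_X {n : ℕ} {s : ℂ[X]} {φ : Module.End ℂ ℂ[X]} (hφ : HasSymbol n s φ) :
    HasSymbol n (X * s) (φ * mulOp X) := by
  induction n generalizing s φ with
  | zero =>
    rw [HasSymbol] at *
    rw [hφ]
    refine LinearMap.ext fun f => ?_
    simp only [Module.End.mul_apply, LinearMap.mulLeft_apply]; ring
  | succ n ih =>
    rw [HasSymbol] at *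
    have := ih hφ
    rw [mul_smul_comm] at this
    convert this using 1
    simp only [adX, sub_mul, mul_assoc]

theorem lift {n : ℕ} {s : ℂ[X]} {φ : Module.End ℂ ℂ[X]} (hφ : HasSymbol n s φ) :
    HasSymbol (n + 1) 0 φ := by
  induction n generalizing s φ with
  | zero =>
    rw [HasSymbol] at hφ
    rw [HasSymbol, smul_zero, adX, hφ, mulOp_commute, sub_self]
    exact zero 0
  | succ n ih => rw [HasSymbol]; simpa using ih hφ

theorem lift_of_lt {n m : ℕ} {s : ℂ[X]} {φ : Module.End ℂ ℂ[X]} (hφ : HasSymbol n s φ)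
    (h : n < m) : HasSymbol m 0 φ := by
  induction h with
  | refl => exact hφ.lift
  | step _ ih => exact ih.lift

theorem derivOp_mul {n : ℕ} {s : ℂ[X]} {φ : Module.End ℂ ℂ[X]} (hφ : HasSymbol n s φ) :
    HasSymbol (n + 1) s (derivOp * φ) := by
  have key : ∀ φ : Module.End ℂ ℂ[X], adX (derivOp * φ) = φ + derivOp * adX φ := fun φ => by
    have : derivOp * (mulOp X * φ) = (mulOp X * derivOp + 1) * φ := by
      rw [← mul_assoc, derivOp_mulOp_X]
    simp only [adX, mul_sub, this]; noncomm_ring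
  induction n generalizing s φ with
  | zero =>
    rw [HasSymbol, key]
    rw [HasSymbol] at hφ
    have h0 : adX φ = 0 := by rw [adX, hφ, mulOp_commute, sub_self]
    rw [h0, mul_zero, add_zero, HasSymbol, hφ]
    simp
  | succ n ih =>
    rw [HasSymbol, key]
    have := hφ.add (ih (s := (n + 1 : ℂ) • s) hφ)
    convert this using 1
    push_cast
    module

theorem unique {n : ℕ} {s t : ℂ[X]} {φ : Module.End ℂ ℂ[X]} (hs : HasSymbol n s φ)
    (ht : HasSymbol n t φ) : s = t := by
  induction n generalizing s t φ with
  | zero =>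
    rw [HasSymbol] at *
    have := congrArg (fun ψ : Module.End ℂ ℂ[X] => ψ 1) (hs.symm.trans ht)
    simpa using this
  | succ n ih => exact smul_right_injective _ (Nat.cast_add_one_ne_zero n) (ih hs ht)

theorem one : HasSymbol 0 1 1 := by rw [HasSymbol]; refine LinearMap.ext fun f => ?_; simp

end HasSymbol

/-- The Laguerre differential operator `-(x ∂² + (α + 1 - x) ∂)`. -/
def laguerreOp (α : ℝ) : Module.End ℂ ℂ[X] :=
  -(mulOp X * (derivOp * derivOp) + mulOp (C (α + 1 : ℂ) - X) * derivOp)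

theorem HasSymbol.laguerreOp_mul (α : ℝ) {n : ℕ} {s : ℂ[X]} {φ : Module.End ℂ ℂ[X]}
    (hφ : HasSymbol n s φ) : HasSymbol (n + 2) (-X * s) (laguerreOp α * φ) := by
  have h1 := hφ.derivOp_mul
  have h2 := h1.derivOp_mul.mulOp_mul X
  have h3 := (h1.mulOp_mul (C (α + 1 : ℂ) - X)).lift
  convert (h2.add h3).smul (-1) using 1
  · simp
  · refine LinearMap.ext fun f => ?_; simp [laguerreOp]; ring

theorem HasSymbol.laguerreOp_pow (α : ℝ) (d : ℕ) :
    HasSymbol (2 * d) ((-X) ^ d) (laguerreOp α ^ d) := by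
  induction d with
  | zero => simpa using HasSymbol.one
  | succ d ih => rw [pow_succ', pow_succ']; exact ih.laguerreOp_mul α

theorem HasSymbol.aeval_laguerreOp (α : ℝ) (p : ℂ[X]) :
    HasSymbol (2 * p.natDegree) (p.leadingCoeff • (-X) ^ p.natDegree)
      (aeval (laguerreOp α) p) := by
  rw [aeval_eq_sum_range, Finset.sum_range_succ]
  have h := (HasSymbol.laguerreOp_pow α p.natDegree).smul p.leadingCoeff
  have h' : HasSymbol (2 * p.natDegree) (∑ i ∈ Finset.range p.natDegree, (0 : ℂ[X]))
      (∑ i ∈ Finset.range p.natDegree, p.coeff i • laguerreOp α ^ i) :=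
    HasSymbol.sum fun i hi => ((HasSymbol.laguerreOp_pow α i).smul (p.coeff i)).lift_of_lt
      (by have := Finset.mem_range.mp hi; omega)
  simpa using h'.add h

end Symbol

/-- Up to a power of `X`, the operator `φ` multiplies `X ^ k` by a polynomial whose coefficients
depend polynomially on `k`; differential operators with polynomial coefficients have this form. -/
def IsTame (φ : Module.End ℂ ℂ[X]) : Prop :=
  ∃ (n : ℕ) (B : ℂ[X][X]), ∀ k : ℕ, X ^ n * φ (X ^ k) = X ^ k * B.eval (C (k : ℂ))

namespace IsTame

theorem one : IsTame 1 := ⟨0, 1, fun k => by simp⟩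

theorem zero : IsTame 0 := ⟨0, 0, fun k => by simp⟩

theorem add {φ ψ : Module.End ℂ ℂ[X]} (hφ : IsTame φ) (hψ : IsTame ψ) : IsTame (φ + ψ) := by
  obtain ⟨n, B, hB⟩ := hφ
  obtain ⟨m, B', hB'⟩ := hψ
  refine ⟨n + m, C (X ^ m) * B + C (X ^ n) * B', fun k => ?_⟩
  simp only [LinearMap.add_apply, eval_add, eval_mul, eval_C]
  linear_combination X ^ m * hB k + X ^ n * hB' k

theorem sum {ι : Type*} {S : Finset ι} {φ : ι → Module.End ℂ ℂ[X]} (h : ∀ i ∈ S, IsTame (φ i)) :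
    IsTame (∑ i ∈ S, φ i) := by
  classical
  induction S using Finset.induction_on with
  | empty => simpa using zero
  | insert i S hi ih =>
    rw [Finset.sum_insert hi]
    exact (h i (by simp)).add (ih fun j hj => h j (by simp [hj]))

theorem mulOp_mul {φ : Module.End ℂ ℂ[X]} (p : ℂ[X]) (hφ : IsTame φ) : IsTame (mulOp p * φ) := by
  obtain ⟨n, B, hB⟩ := hφ
  refine ⟨n, C p * B, fun k => ?_⟩
  simp only [Module.End.mul_apply, LinearMap.mulLeft_apply, eval_mul, eval_C]
  linear_combination p * hB k

theorem mul_mulOp_X {φ : Module.End ℂ ℂ[X]} (hφ : IsTame φ) : IsTame (φ * mulOp X) := by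
  obtain ⟨n, B, hB⟩ := hφ
  refine ⟨n, C X * taylor 1 B, fun k => ?_⟩
  have := hB (k + 1)
  simp only [Module.End.mul_apply, LinearMap.mulLeft_apply, eval_mul, eval_C, taylor_eval]
  rw [← pow_succ', this]
  simp
  ring

theorem mul_derivOp {φ : Module.End ℂ ℂ[X]} (hφ : IsTame φ) : IsTame (φ * derivOp) := by
  obtain ⟨n, B, hB⟩ := hφ
  refine ⟨n + 1, X * taylor (-1) B, fun k => ?_⟩
  cases k with
  | zero => simp
  | succ k =>
    have h1 : derivative (X ^ (k + 1) : ℂ[X]) = (k + 1 : ℂ) • X ^ k := by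
      rw [derivative_X_pow, smul_eq_C_mul]; simp
    have := hB k
    simp only [Module.End.mul_apply, eval_mul, eval_X, taylor_eval, h1, map_smul]
    rw [mul_smul_comm, pow_succ', mul_assoc, this, smul_eq_C_mul]
    simp
    ring

theorem mul_derivOp_pow {φ : Module.End ℂ ℂ[X]} (hφ : IsTame φ) (r : ℕ) :
    IsTame (φ * derivOp ^ r) := by
  induction r with
  | zero => simpa using hφ
  | succ r ih => rw [pow_succ, ← mul_assoc]; exact ih.mul_derivOp

theorem exists_coeff {φ : Module.End ℂ ℂ[X]} (hφ : IsTame φ) :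
    ∃ q : ℂ[X], ∀ k : ℕ, (φ (X ^ k)).coeff k = q.eval (k : ℂ) := by
  obtain ⟨n, B, hB⟩ := hφ
  have : ∀ B : ℂ[X][X], ∃ q : ℂ[X], ∀ k : ℕ, (B.eval (C (k : ℂ))).coeff n = q.eval (k : ℂ) := by
    intro B
    induction B using Polynomial.induction_on' with
    | add p q hp hq =>
      obtain ⟨p', hp⟩ := hp
      obtain ⟨q', hq⟩ := hq
      exact ⟨p' + q', fun k => by simp only [eval_add, coeff_add, hp, hq]⟩
    | monomial d u =>
      refine ⟨C (u.coeff n) * X ^ d, fun k => ?_⟩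
      rw [eval_monomial, ← C_pow, coeff_mul_C]; simp
  obtain ⟨q, hq⟩ := this B
  refine ⟨q, fun k => ?_⟩
  rw [← hq, ← coeff_X_pow_mul (φ (X ^ k)) n k, hB, add_comm, coeff_X_pow_mul]

end IsTame

theorem IsLaguerre.exists_moment₂ {α : ℝ} {L : ℂ[X] →ₗ[ℂ] ℂ} (hL : IsLaguerre α L) (g : ℂ[X])
    (B : ℂ[X][X]) : ∃ Q : ℂ[X], ∀ k : ℕ,
      L (X ^ k * B.eval (C (k : ℂ)) * g) = Q.eval (k : ℂ) * L (X ^ k) := by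
  induction B using Polynomial.induction_on' with
  | add p q hp hq =>
    obtain ⟨p', hp⟩ := hp
    obtain ⟨q', hq⟩ := hq
    exact ⟨p' + q', fun k => by simp only [eval_add, mul_add, add_mul, map_add, hp, hq]⟩
  | monomial d u =>
    obtain ⟨Q, -, hQ⟩ := hL.exists_moment (u * g)
    refine ⟨X ^ d * Q, fun k => ?_⟩
    rw [eval_monomial, ← C_pow, show X ^ k * (u * C ((k : ℂ) ^ d)) * g =
      ((k : ℂ) ^ d) • (X ^ k * (u * g)) by rw [smul_eq_C_mul]; ring, map_smul, hQ]
    simp [mul_assoc]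

theorem IsTame.eq_zero_of_adjoint {α α' : ℝ} {L L' : ℂ[X] →ₗ[ℂ] ℂ} (hL : IsLaguerre α L)
    (hL' : IsLaguerre α' L') (hint : ¬ ∃ k : ℤ, α - α' = (k : ℝ)) {φ : Module.End ℂ ℂ[X]}
    (hφ : IsTame φ) (hadj : ∀ g, ∃ h, ∀ f, L (φ f * g) = L' (f * h)) : φ = 0 := by
  obtain ⟨n, B, hB⟩ := hφ
  have h0 : ∀ k, φ (X ^ k) = 0 := fun k => by
    refine hL.eq_zero (K := n) fun l => ?_
    obtain ⟨Q, hQ⟩ := hL.exists_moment₂ (X ^ l) B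
    obtain ⟨h, hh⟩ := hadj (X ^ (n + l))
    obtain ⟨Q', -, hQ'⟩ := hL'.exists_moment h
    have e : ∀ k : ℕ, L (φ (X ^ k) * X ^ (n + l)) = Q.eval (k : ℂ) * L (X ^ k) := fun k => by
      rw [← hQ, ← hB]; congr 1; ring
    have hQ0 : Q = 0 := hL.moments_incompatible hL' hint fun k => by rw [← e, ← hQ', hh]
    rw [e, hQ0]; simp
  refine LinearMap.ext fun f => ?_
  induction f using Polynomial.induction_on' with
  | add p q hp hq => rw [map_add, hp, hq]; simp
  | monomial k c => rw [← C_mul_X_pow_eq_monomial, ← smul_eq_C_mul, map_smul, h0]; simp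

theorem laguerreOp_coeff (α : ℝ) (f : ℂ[X]) (j : ℕ) :
    (laguerreOp α f).coeff j = j * f.coeff j - (j + 1) * (j + α + 1) * f.coeff (j + 1) := by
  have : laguerreOp α f =
      X * derivative f - X * derivative (derivative f) - C (α + 1 : ℂ) * derivative f := by
    simp [laguerreOp]; ring
  rw [this, coeff_sub, coeff_sub, coeff_C_mul]
  cases j with
  | zero => simp [coeff_derivative]
  | succ j => simp only [coeff_X_mul, coeff_derivative]; push_cast; ring

/-- Laguerre polynomials: eigenvectors of the Laguerre operator, of every degree. -/
theorem exists_laguerre {α : ℝ} (hα : -1 < α) (k : ℕ) :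
    ∃ p : ℂ[X], p.degree = k ∧ laguerreOp α p = (k : ℂ) • p := by
  have hne : ∀ j : ℕ, (j + α + 1 : ℂ) ≠ 0 := fun j => by
    have : (0 : ℝ) < j + α + 1 := by linarith [j.cast_nonneg (α := ℝ)]
    exact_mod_cast this.ne'
  let c : ℕ → ℂ := fun j => Nat.rec 1 (fun j x => (j - k : ℂ) / ((j + 1) * (j + α + 1)) * x) j
  have hc : ∀ j, (j + 1) * (j + α + 1) * c (j + 1) = (j - k : ℂ) * c j := fun j => by
    change (j + 1) * (j + α + 1) * ((j - k : ℂ) / ((j + 1) * (j + α + 1)) * c j) = _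
    have h1 := hne j
    have h2 : (j + 1 : ℂ) ≠ 0 := Nat.cast_add_one_ne_zero j
    field_simp
  have hck : c k ≠ 0 := by
    have : ∀ j ≤ k, c j ≠ 0 := fun j => by
      induction j with
      | zero => intro _; exact one_ne_zero
      | succ j ih =>
        intro hj h0
        have := hc j
        rw [h0, mul_zero, eq_comm, mul_eq_zero, sub_eq_zero] at this
        rcases this with h | h
        · have : j = k := by exact_mod_cast h
          omega
        · exact ih (by omega) h
    exact this k le_rfl
  have hc0 : ∀ j, c (k + 1 + j) = 0 := fun j => by
    induction j with
    | zero =>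
      have := hc k
      rw [sub_self, zero_mul] at this
      exact (mul_eq_zero.mp this).resolve_left
        (mul_ne_zero (Nat.cast_add_one_ne_zero k) (hne k))
    | succ j ih =>
      have := hc (k + 1 + j)
      rw [ih, mul_zero] at this
      exact (mul_eq_zero.mp this).resolve_left
        (mul_ne_zero (Nat.cast_add_one_ne_zero _) (hne _))
  have hcoeff : ∀ j, (∑ i ∈ Finset.range (k + 1), monomial i (c i)).coeff j = c j := fun j => by
    rw [finsetSum_coeff]
    simp only [coeff_monomial, Finset.sum_ite_eq', Finset.mem_range]
    split_ifs with h
    · rfl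
    · have := hc0 (j - (k + 1))
      rw [show k + 1 + (j - (k + 1)) = j by omega] at this
      exact this.symm
  refine ⟨∑ i ∈ Finset.range (k + 1), monomial i (c i), le_antisymm ?_ ?_, ?_⟩
  · rw [degree_le_iff_coeff_zero]
    intro j hj
    rw [hcoeff]
    have h : k < j := by exact_mod_cast hj
    have := hc0 (j - (k + 1))
    rwa [show k + 1 + (j - (k + 1)) = j by omega] at this
  · exact le_degree_of_ne_zero (by rwa [hcoeff])
  · ext j
    rw [laguerreOp_coeff, coeff_smul, hcoeff, hcoeff, hc, smul_eq_mul]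
    ring

theorem IsLaguerre.laguerreOp_mul {α : ℝ} {L : ℂ[X] →ₗ[ℂ] ℂ} (hL : IsLaguerre α L) (f g : ℂ[X]) :
    L (laguerreOp α f * g) = L (X * derivative f * derivative g) := by
  induction f using Polynomial.induction_on' with
  | add p q hp hq => simp only [map_add, add_mul, mul_add, hp, hq]
  | monomial k c =>
  induction g using Polynomial.induction_on' with
  | add p q hp hq => simp only [map_add, mul_add, hp, hq]
  | monomial l d =>
  rw [← C_mul_X_pow_eq_monomial, ← C_mul_X_pow_eq_monomial, ← smul_eq_C_mul, ← smul_eq_C_mul]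
  simp only [map_smul, smul_mul_assoc, mul_smul_comm]
  congr 2
  cases k with
  | zero => simp [laguerreOp]
  | succ k =>
    have h1 : laguerreOp α (X ^ (k + 1)) =
        (k + 1 : ℂ) • X ^ (k + 1) - ((k + 1) * (k + α + 1) : ℂ) • X ^ k := by
      ext j
      rw [laguerreOp_coeff]
      simp only [coeff_X_pow, coeff_sub, coeff_smul, smul_eq_mul, add_left_inj]
      split_ifs with h2 h3 h3
      · omega
      · subst h2; push_cast; ring
      · subst h3; ring
      · ring
    rw [h1, sub_mul, smul_mul_assoc, smul_mul_assoc, map_sub, map_smul, map_smul, ← pow_add,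
      ← pow_add]
    cases l with
    | zero => simp [hL.succ]; ring
    | succ l =>
      have h2 : X * derivative (X ^ (k + 1)) * derivative (X ^ (l + 1)) =
          ((k + 1) * (l + 1) : ℂ) • (X : ℂ[X]) ^ (k + (l + 1)) := by
        simp only [derivative_X_pow, smul_eq_C_mul]; simp; ring
      rw [h2, map_smul, show k + 1 + (l + 1) = (k + (l + 1)) + 1 by ring, hL.succ]
      simp only [smul_eq_mul]; push_cast; ring

theorem IsLaguerre.laguerreOp_symm {α : ℝ} {L : ℂ[X] →ₗ[ℂ] ℂ} (hL : IsLaguerre α L)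
    (f g : ℂ[X]) : L (laguerreOp α f * g) = L (f * laguerreOp α g) := by
  rw [hL.laguerreOp_mul f g, mul_comm f, hL.laguerreOp_mul g f, mul_right_comm]

/-- A family with one polynomial in each degree spans. -/
theorem degree_induction {p : ℕ → ℂ[X]} (hp : ∀ k, (p k).degree = k) (S : Submodule ℂ ℂ[X])
    {n : ℕ} (h : ∀ k < n, p k ∈ S) {f : ℂ[X]} (hf : f.degree < n) : f ∈ S := by
  induction n generalizing f with
  | zero =>
    rw [degree_lt_iff_coeff_zero] at hf
    rw [show f = 0 by ext j; simpa using hf j (Nat.zero_le j)]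
    exact S.zero_mem
  | succ n ih =>
    have hpn : (p n).coeff n ≠ 0 := coeff_ne_zero_of_eq_degree (hp n)
    have hlt : (f - (f.coeff n / (p n).coeff n) • p n).degree < n := by
      rw [degree_lt_iff_coeff_zero] at hf ⊢
      intro j hj
      rcases hj.eq_or_lt with rfl | hj
      · simp [hpn]
      · have : (p n).coeff j = 0 := coeff_eq_zero_of_degree_lt (by rw [hp]; exact_mod_cast hj)
        simp [hf j hj, this]
    have := S.add_mem (ih (fun k hk => h k (by omega)) hlt)
      (S.smul_mem (f.coeff n / (p n).coeff n) (h n (by omega)))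
    simpa using this

theorem degree_induction' {p : ℕ → ℂ[X]} (hp : ∀ k, (p k).degree = k) (S : Submodule ℂ ℂ[X])
    (h : ∀ k, p k ∈ S) (f : ℂ[X]) : f ∈ S :=
  degree_induction hp S (n := f.natDegree + 1) (fun k _ => h k)
    (degree_le_natDegree.trans_lt (by exact_mod_cast Nat.lt_succ_self _))

/-- A tame operator that, together with its adjoint, does not raise degrees is a polynomial in the
Laguerre operator. -/
theorem IsTame.eq_aeval {α : ℝ} {L : ℂ[X] →ₗ[ℂ] ℂ} (hL : IsLaguerre α L)
    {φ : Module.End ℂ ℂ[X]} (hφ : IsTame φ)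
    (hdeg : ∀ (k : ℕ) (f : ℂ[X]), f.degree < k → (φ f).degree < k)
    (hadj : ∀ (k : ℕ) (g : ℂ[X]), g.degree < k → ∃ h : ℂ[X], h.degree < k ∧
      ∀ f, L (φ f * g) = L (f * h)) :
    ∃ q : ℂ[X], φ = aeval (laguerreOp α) q ∧ ∀ k : ℕ, (φ (X ^ k)).coeff k = q.eval (k : ℂ) := by
  choose p hp hpe using exists_laguerre hL.gt
  obtain ⟨q, hq⟩ := hφ.exists_coeff
  have horth₀ : ∀ k j : ℕ, k ≠ j → L (p k * p j) = 0 := fun k j hkj => by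
    have := hL.laguerreOp_symm (p k) (p j)
    rw [hpe, hpe, smul_mul_assoc, mul_smul_comm, map_smul, map_smul, ← sub_eq_zero,
      ← sub_smul, smul_eq_zero, sub_eq_zero] at this
    exact this.resolve_left (by exact_mod_cast hkj)
  have horth : ∀ (k : ℕ) (g : ℂ[X]), degree g < k → L (p k * g) = 0 := fun k g hg =>
    degree_induction hp (LinearMap.ker (L ∘ₗ LinearMap.mulLeft ℂ (p k)))
      (fun j hj => by simpa using horth₀ k j hj.ne') hg
  have hφp : ∀ k : ℕ, φ (p k) = q.eval (k : ℂ) • p k := fun k => by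
    have hX : degree (p k - (p k).coeff k • X ^ k) < (k : WithBot ℕ) := by
      rw [degree_lt_iff_coeff_zero]
      intro j hj
      rcases hj.eq_or_lt with rfl | hj
      · simp
      · have : (p k).coeff j = 0 := coeff_eq_zero_of_degree_lt (by rw [hp]; exact_mod_cast hj)
        simp [this, coeff_X_pow, hj.ne']
    have hu : degree (φ (p k) - q.eval (k : ℂ) • p k) < (k : WithBot ℕ) := by
      have hle : (φ (p k)).degree < (k + 1 : ℕ) :=
        hdeg _ _ (by rw [hp]; exact_mod_cast Nat.lt_succ_self k)
      have hc : (φ (p k)).coeff k = q.eval (k : ℂ) * (p k).coeff k := by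
        have h1 := coeff_eq_zero_of_degree_lt (hdeg _ _ hX)
        rw [map_sub, map_smul, coeff_sub, coeff_smul, hq, smul_eq_mul] at h1
        linear_combination h1
      rw [degree_lt_iff_coeff_zero] at hle ⊢
      intro j hj
      rcases hj.eq_or_lt with rfl | hj
      · simp [hc]
      · have : (p k).coeff j = 0 := coeff_eq_zero_of_degree_lt (by rw [hp]; exact_mod_cast hj)
        simp [this, hle j hj]
    refine sub_eq_zero.mp (hL.eq_zero_of_forall fun g => ?_)
    refine degree_induction' hp
      (LinearMap.ker (L ∘ₗ LinearMap.mulLeft ℂ (φ (p k) - q.eval (k : ℂ) • p k))) (fun j => ?_) g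
    rw [LinearMap.mem_ker, LinearMap.comp_apply, LinearMap.mulLeft_apply]
    rcases lt_or_ge j k with hjk | hjk
    · obtain ⟨h, hh, hhL⟩ := hadj k (p j) (by rw [hp]; exact_mod_cast hjk)
      rw [sub_mul, smul_mul_assoc, map_sub, map_smul, hhL, horth k h hh, horth₀ k j hjk.ne']
      simp
    · rw [mul_comm]
      exact horth j _ (hu.trans_le (by exact_mod_cast hjk))
  refine ⟨q, LinearMap.ext fun f => ?_, hq⟩
  refine degree_induction' hp (LinearMap.eqLocus φ (aeval (laguerreOp α) q)) (fun k => ?_) f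
  have hne : p k ≠ 0 := by rintro h0; simpa [h0] using hp k
  rw [LinearMap.mem_eqLocus, hφp,
    Module.End.aeval_apply_of_hasEigenvector ⟨Module.End.mem_eigenspace_iff.mpr (hpe k), hne⟩]

section Vector

variable {ι : Type*}

/-- Vectors of polynomials of degree less than `k`. -/
def vecDegreeLT (ι : Type*) (k : ℕ) : Submodule ℂ (ι → ℂ[X]) :=
  Submodule.pi Set.univ fun _ => degreeLT ℂ k

theorem mem_vecDegreeLT {k : ℕ} {v : ι → ℂ[X]} :
    v ∈ vecDegreeLT ι k ↔ ∀ i, (v i).degree < k := by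
  simp [vecDegreeLT, Submodule.mem_pi, mem_degreeLT]

theorem vecDegreeLT_mono {k m : ℕ} (h : k ≤ m) : vecDegreeLT ι k ≤ vecDegreeLT ι m :=
  fun _ hv => mem_vecDegreeLT.mpr fun i => (mem_vecDegreeLT.mp hv i).trans_le (by exact_mod_cast h)

theorem exists_mem_vecDegreeLT [Fintype ι] (v : ι → ℂ[X]) : ∃ k, v ∈ vecDegreeLT ι k := by
  refine ⟨Finset.univ.sup (fun i => (v i).natDegree) + 1, mem_vecDegreeLT.mpr fun i => ?_⟩
  refine degree_le_natDegree.trans_lt ?_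
  exact_mod_cast Nat.lt_succ_of_le
    (Finset.le_sup (f := fun i => (v i).natDegree) (Finset.mem_univ i))

/-- The vectors `R k s` behave like the rows of a sequence of monic matrix polynomials. -/
def IsMonicSeq [DecidableEq ι] (R : ℕ → ι → ι → ℂ[X]) : Prop :=
  ∀ k s, R k s - Pi.single s (X ^ k) ∈ vecDegreeLT ι k

namespace IsMonicSeq

variable [DecidableEq ι] {R R' : ℕ → ι → ι → ℂ[X]}

theorem mem_vecDegreeLT (hR : IsMonicSeq R) {k m : ℕ} (h : k < m) (s : ι) :
    R k s ∈ vecDegreeLT ι m := by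
  have h1 : (Pi.single s (X ^ k) : ι → ℂ[X]) ∈ vecDegreeLT ι m := by
    refine _root_.mem_vecDegreeLT.mpr fun i => ?_
    rcases eq_or_ne i s with rfl | hi
    · simpa using h
    · simp [Pi.single_eq_of_ne hi]
  simpa using Submodule.add_mem _ (vecDegreeLT_mono h.le (hR k s)) h1

variable [Fintype ι]

theorem vecDegreeLT_le (hR : IsMonicSeq R) {S : Submodule ℂ (ι → ℂ[X])} {k : ℕ}
    (h : ∀ m < k, ∀ s, R m s ∈ S) : vecDegreeLT ι k ≤ S := by
  induction k with
  | zero =>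
    intro v hv
    rw [show v = 0 by
      funext i; simpa [Nat.WithBot.lt_zero_iff] using _root_.mem_vecDegreeLT.mp hv i]
    exact S.zero_mem
  | succ k ih =>
    intro v hv
    have h1 : v - ∑ s, (v s).coeff k • (Pi.single s (X ^ k) : ι → ℂ[X]) ∈ vecDegreeLT ι k := by
      refine _root_.mem_vecDegreeLT.mpr fun i => ?_
      have : (∑ s, (v s).coeff k • (Pi.single s (X ^ k) : ι → ℂ[X])) i = (v i).coeff k • X ^ k := by
        rw [Finset.sum_apply, Finset.sum_eq_single i]
        · simp
        · intro j _ hj; simp [Pi.single_eq_of_ne hj.symm]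
        · simp
      rw [Pi.sub_apply, this, degree_lt_iff_coeff_zero]
      intro j hj
      have hvi := (degree_lt_iff_coeff_zero _ _).mp (_root_.mem_vecDegreeLT.mp hv i)
      rcases hj.eq_or_lt with rfl | hj
      · simp
      · simp [hvi j hj, coeff_X_pow, hj.ne']
    have h2 : ∑ s, (v s).coeff k • (R k s - Pi.single s (X ^ k)) ∈ vecDegreeLT ι k :=
      Submodule.sum_mem _ fun s _ => Submodule.smul_mem _ _ (hR k s)
    have h3 := ih (fun m hm => h m (by omega)) (Submodule.sub_mem _ h1 h2)
    have h4 : ∑ s, (v s).coeff k • R k s ∈ S :=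
      Submodule.sum_mem _ fun s _ => Submodule.smul_mem _ _ (h k (by omega) s)
    have := S.add_mem h3 h4
    simp only [smul_sub, Finset.sum_sub_distrib] at this
    convert this using 1
    abel

theorem mem_of_forall (hR : IsMonicSeq R) {S : Submodule ℂ (ι → ℂ[X])}
    (h : ∀ m s, R m s ∈ S) (v : ι → ℂ[X]) : v ∈ S :=
  let ⟨_, hk⟩ := exists_mem_vecDegreeLT v
  hR.vecDegreeLT_le (fun m _ => h m) hk

theorem finiteDimensional (hR : IsMonicSeq R) (k : ℕ) :
    FiniteDimensional ℂ (vecDegreeLT ι k) := by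
  have : FiniteDimensional ℂ
      (Submodule.span ℂ (Set.range fun x : Fin k × ι => R x.1 x.2)) :=
    FiniteDimensional.span_of_finite ℂ (Set.finite_range _)
  have hle : vecDegreeLT ι k ≤ Submodule.span ℂ (Set.range fun x : Fin k × ι => R x.1 x.2) :=
    hR.vecDegreeLT_le fun m hm s => Submodule.subset_span ⟨((⟨m, hm⟩ : Fin k), s), rfl⟩
  exact Submodule.finiteDimensional_of_le hle

theorem map_mem_vecDegreeLT (hR : IsMonicSeq R) {D : Module.End ℂ (ι → ℂ[X])}
    (hD : ∀ k s, D (R k s) ∈ Submodule.span ℂ (Set.range (R k))) {k : ℕ} {v : ι → ℂ[X]}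
    (hv : v ∈ vecDegreeLT ι k) : D v ∈ vecDegreeLT ι k := by
  refine hR.vecDegreeLT_le (S := (vecDegreeLT ι k).comap D) (fun m hm s => ?_) hv
  refine (Submodule.span_le (p := vecDegreeLT ι k)).mpr ?_ (hD m s)
  rintro _ ⟨t, rfl⟩
  exact hR.mem_vecDegreeLT hm t

variable {β : (ι → ℂ[X]) →ₗ[ℂ] (ι → ℂ[X]) →ₗ[ℂ] ℂ}

theorem apply_eq_zero (hR' : IsMonicSeq R')
    (horth : ∀ k m, k ≠ m → ∀ s t, β (R k s) (R' m t) = 0) {k m : ℕ} (h : k ≤ m) (s : ι)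
    {q : ι → ℂ[X]} (hq : q ∈ vecDegreeLT ι k) : β (R m s) q = 0 :=
  hR'.vecDegreeLT_le (S := LinearMap.ker (β (R m s)))
    (fun j hj t => horth m j (by omega) s t) hq

/-- Operators having orthogonal polynomials as eigenfunctions possess an adjoint which does not
raise degrees. -/
theorem exists_adjoint (hR : IsMonicSeq R) (hR' : IsMonicSeq R')
    (hβ : ∀ h, (∀ p, β p h = 0) → h = 0)
    (horth : ∀ k m, k ≠ m → ∀ s t, β (R k s) (R' m t) = 0) {D : Module.End ℂ (ι → ℂ[X])}
    (hD : ∀ k s, D (R k s) ∈ Submodule.span ℂ (Set.range (R k))) {k : ℕ} {q : ι → ℂ[X]}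
    (hq : q ∈ vecDegreeLT ι k) : ∃ h ∈ vecDegreeLT ι k, ∀ p, β (D p) q = β p h := by
  have := hR.finiteDimensional k
  let Φ : vecDegreeLT ι k →ₗ[ℂ] Module.Dual ℂ (vecDegreeLT ι k) :=
    β.flip.domRestrict₁₂ (vecDegreeLT ι k) (vecDegreeLT ι k)
  have hinj : Function.Injective Φ := by
    rw [injective_iff_map_eq_zero]
    intro h hh
    refine Subtype.ext (hβ _ fun p => ?_)
    refine hR.mem_of_forall (S := LinearMap.ker (β.flip h)) (fun m s => ?_) p
    rcases lt_or_ge m k with hm | hm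
    · exact LinearMap.congr_fun hh ⟨R m s, hR.mem_vecDegreeLT hm s⟩
    · exact hR'.apply_eq_zero horth hm s h.2
  have hsurj : Function.Surjective Φ :=
    (LinearMap.injective_iff_surjective_of_finrank_eq_finrank
      Subspace.dual_finrank_eq.symm).mp hinj
  obtain ⟨h, hh⟩ := hsurj ((β.flip q ∘ₗ D).domRestrict (vecDegreeLT ι k))
  refine ⟨h, h.2, fun p => ?_⟩
  refine hR.mem_of_forall (S := LinearMap.eqLocus (β.flip q ∘ₗ D) (β.flip h)) (fun m s => ?_) p
  rcases lt_or_ge m k with hm | hm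
  · exact (LinearMap.congr_fun hh ⟨R m s, hR.mem_vecDegreeLT hm s⟩).symm
  · have h1 : β.flip q (D (R m s)) = 0 := by
      refine (Submodule.span_le (p := LinearMap.ker (β.flip q))).mpr ?_ (hD m s)
      rintro _ ⟨t, rfl⟩
      exact hR'.apply_eq_zero horth hm t hq
    have h2 : β.flip h (R m s) = 0 := hR'.apply_eq_zero horth hm s h.2
    rw [LinearMap.mem_eqLocus, LinearMap.comp_apply, h1, h2]

end IsMonicSeq

end Vector

section Twist

variable {ι : Type*}

/-- The `(i, j)` entry of an operator acting on row vectors. -/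
def entry [DecidableEq ι] (φ : Module.End ℂ (ι → ℂ[X])) (i j : ι) : Module.End ℂ ℂ[X] :=
  LinearMap.proj j ∘ₗ φ ∘ₗ LinearMap.single ℂ (fun _ => ℂ[X]) i

theorem entry_apply [DecidableEq ι] (φ : Module.End ℂ (ι → ℂ[X])) (i j : ι) (f : ℂ[X]) :
    entry φ i j f = φ (Pi.single i f) j := rfl

variable [Fintype ι]

/-- Right multiplication of row vectors by `1 + X A`. -/
def twist (A : Matrix ι ι ℂ) : Module.End ℂ (ι → ℂ[X]) :=
  LinearMap.pi fun j =>
    LinearMap.proj j + mulOp X ∘ₗ ∑ i, A i j • (LinearMap.proj i : (ι → ℂ[X]) →ₗ[ℂ] ℂ[X])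

/-- The bilinear form `∑ i, L i ((p T) i * (q T) i)` with `T = 1 + X A`. -/
def pairing (L : ι → ℂ[X] →ₗ[ℂ] ℂ) (A : Matrix ι ι ℂ) :
    (ι → ℂ[X]) →ₗ[ℂ] (ι → ℂ[X]) →ₗ[ℂ] ℂ :=
  ∑ i, ((LinearMap.mul ℂ ℂ[X]).compr₂ (L i)).compl₁₂
    (LinearMap.proj i ∘ₗ twist A) (LinearMap.proj i ∘ₗ twist A)

theorem twist_apply (A : Matrix ι ι ℂ) (u : ι → ℂ[X]) (j : ι) :
    twist A u j = u j + X * ∑ i, A i j • u i := by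
  simp [twist, Finset.mul_sum]

theorem pairing_apply (L : ι → ℂ[X] →ₗ[ℂ] ℂ) (A : Matrix ι ι ℂ) (p q : ι → ℂ[X]) :
    pairing L A p q = ∑ i, L i (twist A p i * twist A q i) := by
  simp [pairing, LinearMap.sum_apply]

theorem twist_neg_twist {A : Matrix ι ι ℂ} (hA : ∀ i j l, A i j * A j l = 0) (u : ι → ℂ[X]) :
    twist (-A) (twist A u) = u := by
  have h : ∀ j, ∑ i, A i j • (X * ∑ l, A l i • u l) = 0 := fun j => by
    refine Finset.sum_eq_zero fun i _ => ?_
    rw [← mul_smul_comm, Finset.smul_sum]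
    simp [smul_smul, mul_comm (A i j), hA]
  funext j
  have h' := h j
  simp only [twist_apply, Matrix.neg_apply, neg_smul, Finset.sum_neg_distrib, smul_add,
    Finset.sum_add_distrib, h']
  ring

theorem twist_twist_neg {A : Matrix ι ι ℂ} (hA : ∀ i j l, A i j * A j l = 0) (u : ι → ℂ[X]) :
    twist A (twist (-A) u) = u := by
  have := twist_neg_twist (A := -A) (by simpa using hA) u
  rwa [neg_neg] at this

variable [DecidableEq ι]

theorem twist_single (A : Matrix ι ι ℂ) (i : ι) (f : ℂ[X]) :
    twist A (Pi.single i f) = Pi.single i f + ∑ l, A i l • Pi.single l (X * f) := by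
  funext j
  rw [twist_apply, Pi.add_apply, Finset.sum_apply,
    Finset.sum_eq_single i (fun l _ hl => by simp [Pi.single_eq_of_ne hl]) (by simp),
    Finset.sum_eq_single j (fun l _ hl => by simp [Pi.single_eq_of_ne hl.symm]) (by simp)]
  simp

theorem entry_mul_twist (φ : Module.End ℂ (ι → ℂ[X])) (A : Matrix ι ι ℂ) (i j : ι) :
    entry (φ * twist A) i j = entry φ i j + ∑ l, A i l • (entry φ l j * mulOp X) := by
  refine LinearMap.ext fun f => ?_
  simp only [entry_apply, Module.End.mul_apply, LinearMap.add_apply, LinearMap.sum_apply,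
    LinearMap.smul_apply, LinearMap.mulLeft_apply, twist_single, map_add, map_sum, map_smul,
    Pi.add_apply, Finset.sum_apply, Pi.smul_apply]

theorem entry_twist_mul (φ : Module.End ℂ (ι → ℂ[X])) (A : Matrix ι ι ℂ) (i j : ι) :
    entry (twist A * φ) i j = entry φ i j + mulOp X * ∑ l, A l j • entry φ i l := by
  refine LinearMap.ext fun f => ?_
  simp only [entry_apply, Module.End.mul_apply, LinearMap.add_apply, LinearMap.sum_apply,
    LinearMap.smul_apply, LinearMap.mulLeft_apply, twist_apply]

theorem isTame_entry_conj {φ : Module.End ℂ (ι → ℂ[X])} (h : ∀ i j, IsTame (entry φ i j))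
    (A B : Matrix ι ι ℂ) (i j : ι) : IsTame (entry (twist A * (φ * twist B)) i j) := by
  have hsmul : ∀ (c : ℂ) {ψ : Module.End ℂ ℂ[X]}, IsTame ψ → IsTame (c • ψ) := fun c ψ hψ => by
    convert hψ.mulOp_mul (C c) using 1
    refine LinearMap.ext fun f => ?_
    simp [smul_eq_C_mul]
  have h1 : ∀ i j, IsTame (entry (φ * twist B) i j) := fun i j => by
    rw [entry_mul_twist]
    exact (h i j).add (IsTame.sum fun l _ => hsmul _ (h l j).mul_mulOp_X)
  rw [entry_twist_mul]
  exact (h1 i j).add (IsTame.mulOp_mul _ (IsTame.sum fun l _ => hsmul _ (h1 i l)))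

theorem pairing_eq_zero {α : ι → ℝ} {L : ι → ℂ[X] →ₗ[ℂ] ℂ} (hL : ∀ i, IsLaguerre (α i) (L i))
    {A : Matrix ι ι ℂ} (hA : ∀ i j l, A i j * A j l = 0) {h : ι → ℂ[X]}
    (hp : ∀ p, pairing L A p h = 0) : h = 0 := by
  have : twist A h = 0 := by
    funext i
    refine (hL i).eq_zero_of_forall fun g => ?_
    have := hp (twist (-A) (Pi.single i g))
    rw [pairing_apply, twist_twist_neg hA, Finset.sum_eq_single i
      (fun l _ hl => by simp [Pi.single_eq_of_ne hl]) (by simp)] at this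
    simpa [mul_comm] using this
  rw [← twist_neg_twist hA h, this, map_zero]

/-- If conjugation by `1 + X A` makes `D` diagonal, this is the shape of `D`. -/
theorem entry_eq_of_diagonal {A : Matrix ι ι ℂ} (hA : ∀ i j l, A i j * A j l = 0)
    {D E : Module.End ℂ (ι → ℂ[X])} (hDE : D = twist (-A) * (E * twist A))
    (hE : ∀ i j, i ≠ j → entry E i j = 0) (i j : ι) :
    entry D i j = entry E i j + (A i j • (entry E j j * mulOp X) +
      (-A i j) • (mulOp X * entry E i i)) := by
  have h1 : ∀ i j, entry (E * twist A) i j = entry E i j + A i j • (entry E j j * mulOp X) :=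
    fun i j => by
      rw [entry_mul_twist, Finset.sum_eq_single j (fun l _ hl => by simp [hE l j hl]) (by simp)]
  have h2 : ∑ l, (-A) l j • entry (E * twist A) i l = (-A i j) • entry E i i := by
    simp only [h1, smul_add, smul_smul, Matrix.neg_apply, neg_mul, mul_comm (A _ j), hA,
      neg_zero, zero_smul, add_zero]
    exact Finset.sum_eq_single i (fun l _ hl => by simp [hE i l hl.symm]) (by simp)
  rw [hDE, entry_twist_mul, h2, h1, mul_smul_comm, add_assoc]

theorem exists_diagonalization {α : ι → ℝ} {L : ι → ℂ[X] →ₗ[ℂ] ℂ}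
    (hL : ∀ i, IsLaguerre (α i) (L i)) (hα : ∀ i j, i ≠ j → ¬ ∃ k : ℤ, α i - α j = (k : ℝ))
    {A : Matrix ι ι ℂ} (hA : ∀ i j l, A i j * A j l = 0) {D : Module.End ℂ (ι → ℂ[X])}
    (hD : ∀ i j, IsTame (entry D i j))
    (hdeg : ∀ (k : ℕ), ∀ v ∈ vecDegreeLT ι k, D v ∈ vecDegreeLT ι k)
    (hadj : ∀ (k : ℕ), ∀ q ∈ vecDegreeLT ι k, ∃ h ∈ vecDegreeLT ι k,
      ∀ p, pairing L A (D p) q = pairing L A p h) :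
    ∃ q : ι → ℂ[X], (∀ i j, A i j ≠ 0 → taylor 1 (q j) = q i) ∧
      ∀ i j, entry D i j = (if i = j then aeval (laguerreOp (α i)) (q i) else 0) +
        (A i j • (aeval (laguerreOp (α j)) (q j) * mulOp X) +
          (-A i j) • (mulOp X * aeval (laguerreOp (α i)) (q i))) := by
  let E : Module.End ℂ (ι → ℂ[X]) := twist A * (D * twist (-A))
  have hDE : D = twist (-A) * (E * twist A) := by
    refine LinearMap.ext fun u => ?_
    simp [E, Module.End.mul_apply, twist_neg_twist hA]
  have hEtame : ∀ i j, IsTame (entry E i j) := isTame_entry_conj hD A (-A)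
  have hAii : ∀ i, A i i = 0 := fun i => mul_self_eq_zero.mp (hA i i i)
  have hEadj : ∀ (k : ℕ), ∀ q ∈ vecDegreeLT ι k, ∃ h ∈ vecDegreeLT ι k, ∀ i f,
      ∑ j, L j (entry E i j f * twist A q j) = L i (f * twist A h i) := fun k q hq => by
    obtain ⟨h, hh, hp⟩ := hadj k q hq
    refine ⟨h, hh, fun i f => ?_⟩
    have := hp (twist (-A) (Pi.single i f))
    rw [pairing_apply, pairing_apply, twist_twist_neg hA, Finset.sum_eq_single (f := fun j =>
      L j ((Pi.single i f : ι → ℂ[X]) j * twist A h j)) i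
      (fun l _ hl => by simp [Pi.single_eq_of_ne hl]) (by simp)] at this
    simpa [entry_apply, E, Module.End.mul_apply] using this
  have hEoff : ∀ i j, i ≠ j → entry E i j = 0 := fun i j hij => by
    refine (hEtame i j).eq_zero_of_adjoint (hL j) (hL i) (hα j i hij.symm) fun g => ?_
    obtain ⟨k, hk⟩ := exists_mem_vecDegreeLT (twist (-A) (Pi.single j g))
    obtain ⟨h, -, hh⟩ := hEadj k _ hk
    refine ⟨twist A h i, fun f => ?_⟩
    rw [← hh, twist_twist_neg hA, Finset.sum_eq_single j
      (fun l _ hl => by simp [Pi.single_eq_of_ne hl]) (by simp)]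
    simp
  have hDentry := entry_eq_of_diagonal hA hDE hEoff
  have hsingle : ∀ (k : ℕ) (i : ι) (g : ℂ[X]), g.degree < k → Pi.single i g ∈ vecDegreeLT ι k :=
    fun k i g hg => mem_vecDegreeLT.mpr fun j => by
      rcases eq_or_ne j i with rfl | hj
      · simpa using hg
      · simp [Pi.single_eq_of_ne hj]
  have hdiag : ∀ i, ∃ q : ℂ[X], entry E i i = aeval (laguerreOp (α i)) q ∧
      ∀ k : ℕ, (entry E i i (X ^ k)).coeff k = q.eval (k : ℂ) := fun i => by
    refine (hEtame i i).eq_aeval (hL i) (fun k f hf => ?_) fun k g hg => ?_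
    · have := mem_vecDegreeLT.mp (hdeg k _ (hsingle k i f hf)) i
      rwa [← entry_apply, hDentry, hAii, neg_zero, zero_smul, zero_smul, add_zero, add_zero] at this
    · obtain ⟨h, hh, hhE⟩ := hEadj k _ (hsingle k i g hg)
      have hhE' : ∀ l f, L l (entry E l l f * twist A (Pi.single i g) l) = L l (f * twist A h l) :=
        fun l f => by
          rw [← hhE, Finset.sum_eq_single l (fun j _ hj => by simp [hEoff l j hj.symm]) (by simp)]
      have hv : ∀ l, twist A (Pi.single i g) l = (Pi.single i g : ι → ℂ[X]) l + A i l • (X * g) :=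
        fun l => by
          rw [twist_single, Pi.add_apply, Finset.sum_apply, Finset.sum_eq_single l
            (fun j _ hj => by simp [Pi.single_eq_of_ne hj.symm]) (by simp)]
          simp
      have hzero : ∀ l, A l i • twist A h l = 0 := fun l => by
        by_cases hl : A l i = 0
        · rw [hl, zero_smul]
        have hli : l ≠ i := by rintro rfl; exact hl (hAii l)
        have hil : A i l = 0 := (mul_eq_zero.mp (hA l i l)).resolve_left hl
        have : twist A h l = 0 := (hL l).eq_zero_of_forall fun f => by
          rw [mul_comm, ← hhE', hv, hil, Pi.single_eq_of_ne hli]; simp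
        rw [this, smul_zero]
      have hhi : h i = twist A h i := by
        conv_lhs => rw [← twist_neg_twist hA h, twist_apply]
        simp [hzero]
      refine ⟨h i, mem_vecDegreeLT.mp hh i, fun f => ?_⟩
      rw [hhi, ← hhE', hv, hAii]
      simp
  choose q hq hqc using hdiag
  refine ⟨q, fun i j hij => ?_, fun i j => ?_⟩
  · have hne : i ≠ j := by rintro rfl; exact hij (hAii i)
    refine sub_eq_zero.mp (eq_zero_of_eval_natCast fun k => ?_)
    have hk := mem_vecDegreeLT.mp (hdeg (k + 1) _ (hsingle (k + 1) i (X ^ k) (by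
      rw [degree_X_pow]; exact_mod_cast Nat.lt_succ_self k))) j
    have hc := coeff_eq_zero_of_degree_lt hk
    rw [← entry_apply, hDentry, hEoff i j hne] at hc
    simp only [zero_add, LinearMap.add_apply, LinearMap.smul_apply,
      Module.End.mul_apply, LinearMap.mulLeft_apply, coeff_add, coeff_smul, coeff_X_mul,
      smul_eq_mul, ← pow_succ', hqc] at hc
    have : A i j * ((q j).eval (k + 1 : ℂ) - (q i).eval (k : ℂ)) = 0 := by
      push_cast at hc; linear_combination hc
    rw [eval_sub, taylor_eval, (mul_eq_zero.mp this).resolve_left hij]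
  · rw [hDentry, ← hq, ← hq]
    split_ifs with h
    · rw [h]
    · rw [hEoff i j h]

/-- Differential operators having orthogonal polynomials for the form `pairing L A` as
eigenfunctions have even order and scalar leading coefficient. -/
theorem exists_leading_coeff {α : ι → ℝ} {L : ι → ℂ[X] →ₗ[ℂ] ℂ}
    (hL : ∀ i, IsLaguerre (α i) (L i)) (hα : ∀ i j, i ≠ j → ¬ ∃ k : ℤ, α i - α j = (k : ℝ))
    {A : Matrix ι ι ℂ} (hA : ∀ i j l, A i j * A j l = 0)
    (hconn : ∀ i j, Relation.EqvGen (fun i j => A i j ≠ 0) i j)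
    {R R' : ℕ → ι → ι → ℂ[X]} (hR : IsMonicSeq R) (hR' : IsMonicSeq R')
    (horth : ∀ k m, k ≠ m → ∀ s t, pairing L A (R k s) (R' m t) = 0)
    {D : Module.End ℂ (ι → ℂ[X])} (hD : ∀ i j, IsTame (entry D i j))
    (hDR : ∀ k s, D (R k s) ∈ Submodule.span ℂ (Set.range (R k)))
    {n : ℕ} {σ : ι → ι → ℂ[X]} (hσ : ∀ i j, HasSymbol n (σ i j) (entry D i j))
    (hne : ∃ i j, σ i j ≠ 0) :
    ∃ m : ℕ, n = 2 * m ∧ ∃ c : ℂ, ∀ i j, σ i j = if i = j then C c * X ^ m else 0 := by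
  obtain ⟨q, htaylor, hDq⟩ := exists_diagonalization hL hα hA hD
    (fun k v hv => hR.map_mem_vecDegreeLT hDR hv)
    (fun k v hv => hR.exists_adjoint hR' (fun h => pairing_eq_zero hL hA) horth hDR hv)
  have hqconst : ∀ i j, (q i).natDegree = (q j).natDegree ∧
      (q i).leadingCoeff = (q j).leadingCoeff := fun i j => by
    induction hconn i j with
    | rel i j h => rw [← htaylor i j h]; simp [natDegree_taylor, leadingCoeff_taylor]
    | refl i => exact ⟨rfl, rfl⟩
    | symm i j _ ih => exact ⟨ih.1.symm, ih.2.symm⟩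
    | trans i j k _ _ h₁ h₂ => exact ⟨h₁.1.trans h₂.1, h₁.2.trans h₂.2⟩
  obtain ⟨i₀, j₀, hij₀⟩ := hne
  have hq := fun i => hqconst i i₀
  set m := (q i₀).natDegree with hm
  set s : ℂ[X] := (q i₀).leadingCoeff • (-X) ^ m with hs
  have hsymb : ∀ i, HasSymbol (2 * m) s (aeval (laguerreOp (α i)) (q i)) := fun i => by
    have := HasSymbol.aeval_laguerreOp (α i) (q i)
    rwa [(hq i).1, (hq i).2] at this
  have hDs : ∀ i j, HasSymbol (2 * m) (if i = j then s else 0) (entry D i j) := fun i j => by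
    rw [hDq]
    have h1 : HasSymbol (2 * m) (if i = j then s else 0)
        (if i = j then aeval (laguerreOp (α i)) (q i) else 0) := by
      split_ifs
      · exact hsymb i
      · exact HasSymbol.zero _
    have h2 := ((hsymb j).mul_mulOp_X.smul (A i j)).add (((hsymb i).mulOp_mul X).smul (-A i j))
    convert h1.add h2 using 1
    rw [neg_smul, add_neg_cancel, add_zero]
  rcases lt_trichotomy n (2 * m) with h | h | h
  · have h0 := (hDs i₀ i₀).unique ((hσ i₀ i₀).lift_of_lt h)
    rw [if_pos rfl, hs, smul_eq_zero, leadingCoeff_eq_zero] at h0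
    rcases h0 with h0 | h0
    · simp [hm, h0] at h
    · exact absurd h0 (pow_ne_zero _ (neg_ne_zero.mpr X_ne_zero))
  · refine ⟨m, h, (q i₀).leadingCoeff * (-1) ^ m, fun i j => ?_⟩
    subst h
    rw [(hσ i j).unique (hDs i j), hs, smul_eq_C_mul, neg_pow, C_mul, C_pow, C_neg, C_1, mul_assoc]
  · exact absurd ((hσ i₀ j₀).unique ((hDs i₀ j₀).lift_of_lt h)) hij₀

end Twist

section Concrete

/-- The functional `p ↦ ∫ p(x) e^{-x} x^α dx` on `ℂ[X]`, given by its moments. -/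
def laguerreFunctional (α : ℝ) : ℂ[X] →ₗ[ℂ] ℂ :=
  lsum fun k => ((Real.Gamma (k + α + 1) : ℝ) : ℂ) • LinearMap.id

theorem laguerreFunctional_monomial (α : ℝ) (k : ℕ) (c : ℂ) :
    laguerreFunctional α (monomial k c) = Real.Gamma (k + α + 1) * c := by
  simp [laguerreFunctional, lsum_apply, sum_monomial_index]

theorem isLaguerre_laguerreFunctional {α : ℝ} (hα : -1 < α) :
    IsLaguerre α (laguerreFunctional α) := by
  refine ⟨hα, ?_, fun k => ?_⟩
  · rw [← monomial_zero_one, laguerreFunctional_monomial]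
    have : 0 < Real.Gamma ((0 : ℕ) + α + 1) := Real.Gamma_pos_of_pos (by push_cast; linarith)
    simpa using this.ne'
  · have : (k + α + 1 : ℝ) ≠ 0 := by linarith [k.cast_nonneg (α := ℝ)] |> ne_of_gt
    rw [← monomial_one_right_eq_X_pow, ← monomial_one_right_eq_X_pow, laguerreFunctional_monomial,
      laguerreFunctional_monomial,
      show ((k + 1 : ℕ) + α + 1 : ℝ) = (k + α + 1) + 1 by push_cast; ring, Real.Gamma_add_one this]
    push_cast; ring

theorem integral_laguerre {α : ℝ} (hα : -1 < α) (p : ℂ[X]) :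
    IntegrableOn (fun x : ℝ => p.eval (x : ℂ) * ((Real.exp (-x) * x ^ α : ℝ) : ℂ)) (Set.Ioi 0) ∧
      ∫ x in Set.Ioi (0 : ℝ), p.eval (x : ℂ) * ((Real.exp (-x) * x ^ α : ℝ) : ℂ) =
        laguerreFunctional α p := by
  induction p using Polynomial.induction_on' with
  | add p q hp hq =>
    simp only [eval_add, add_mul, map_add]
    exact ⟨hp.1.add hq.1, by rw [integral_add hp.1 hq.1, hp.2, hq.2]⟩
  | monomial k c =>
    have hpos : 0 < (k + α + 1 : ℝ) := by linarith [k.cast_nonneg (α := ℝ)]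
    have hfun : Set.EqOn
        (fun x : ℝ => (monomial k c).eval (x : ℂ) * ((Real.exp (-x) * x ^ α : ℝ) : ℂ))
        (fun x : ℝ => c * ((Real.exp (-x) * x ^ (k + α + 1 - 1) : ℝ) : ℂ)) (Set.Ioi 0) :=
      fun x hx => by
        simp only [eval_monomial]
        rw [add_sub_cancel_right, add_comm (k : ℝ) α, Real.rpow_add_natCast (ne_of_gt hx)]
        push_cast; ring
    have hint := ((Real.GammaIntegral_convergent hpos).ofReal (𝕜 := ℂ)).const_mul c
    refine ⟨(integrableOn_congr_fun hfun measurableSet_Ioi).mpr hint, ?_⟩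
    rw [setIntegral_congr_fun measurableSet_Ioi hfun, integral_const_mul, integral_complex_ofReal,
      ← Real.Gamma_eq_integral hpos, laguerreFunctional_monomial, mul_comm]

variable {N : ℕ}

/-- The rows of a matrix polynomial. -/
def rows (P : (Mat N)[X]) : Matrix (Fin N) (Fin N) ℂ[X] := matPolyEquiv.symm P

/-- The rows of a matrix polynomial, with conjugated coefficients. -/
def conjRows (P : (Mat N)[X]) : Matrix (Fin N) (Fin N) ℂ[X] :=
  (rows P).map (Polynomial.map (starRingEnd ℂ))

theorem rows_coeff (P : (Mat N)[X]) (s i : Fin N) (k : ℕ) :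
    (rows P s i).coeff k = P.coeff k s i := by
  simp [rows]

theorem mval_apply (P : (Mat N)[X]) (x : ℝ) (s i : Fin N) :
    mval P x s i = (rows P s i).eval (x : ℂ) := by
  rw [← matPolyEquiv_eval (rows P) (x : ℂ) s i, rows, AlgEquiv.apply_symm_apply, mval,
    Matrix.scalar_apply, Matrix.smul_one_eq_diagonal]

theorem isMonicSeq_rows {P : ℕ → (Mat N)[X]} (hdeg : ∀ n, (P n).natDegree = n)
    (hmonic : ∀ n, (P n).Monic) : IsMonicSeq fun k => rows (P k) := fun k s => by
  refine mem_vecDegreeLT.mpr fun i => ?_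
  rw [Pi.sub_apply, degree_lt_iff_coeff_zero]
  intro j hj
  rw [coeff_sub, rows_coeff]
  rcases hj.eq_or_lt with rfl | hj
  · have h := hmonic k
    rw [Monic, leadingCoeff, hdeg] at h
    rw [h]
    rcases eq_or_ne i s with rfl | hi
    · simp
    · simp [Pi.single_eq_of_ne hi, Matrix.one_apply_ne hi.symm]
  · rw [coeff_eq_zero_of_natDegree_lt (by rwa [hdeg])]
    rcases eq_or_ne i s with rfl | hi
    · simp [coeff_X_pow, hj.ne']
    · simp [Pi.single_eq_of_ne hi]

theorem isMonicSeq_conjRows {P : ℕ → (Mat N)[X]} (hP : IsMonicSeq fun k => rows (P k)) :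
    IsMonicSeq fun k => conjRows (P k) := fun k s => by
  refine mem_vecDegreeLT.mpr fun i => ?_
  have h := (degree_map_le (f := starRingEnd ℂ)).trans_lt (mem_vecDegreeLT.mp (hP k s) i)
  have hX : (Pi.single s (X ^ k) : Fin N → ℂ[X]) i =
      ((Pi.single s (X ^ k) : Fin N → ℂ[X]) i).map (starRingEnd ℂ) := by
    rcases eq_or_ne i s with rfl | hi
    · simp
    · simp [Pi.single_eq_of_ne hi]
  rw [Pi.sub_apply, hX]
  simpa [conjRows] using h

theorem Amat_apply (a : ℕ → ℝ) (i j : Fin N) :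
    Amat N a i j = ((if (j : ℕ) % 2 = 1 then
      (if (i : ℕ) + 1 = j then a j else if (i : ℕ) = j + 1 then a (j + 1) else 0)
      else 0 : ℝ) : ℂ) := by
  simp only [Amat, EU, Matrix.add_apply, Matrix.sum_apply, Matrix.smul_apply, Matrix.of_apply,
    smul_eq_mul, mul_ite, mul_one, mul_zero]
  have hi := i.2
  have hj := j.2
  have h1 : (∑ l ∈ Finset.Icc 1 (N / 2), if (i : ℕ) + 1 = 2 * l - 1 ∧ (j : ℕ) + 1 = 2 * l then
      (a (2 * l - 1) : ℂ) else 0) =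
      if (j : ℕ) % 2 = 1 ∧ (i : ℕ) + 1 = j then (a j : ℂ) else 0 := by
    split_ifs with h
    · rw [Finset.sum_eq_single (((j : ℕ) + 1) / 2) (fun l _ hl => if_neg (by omega))
        (fun hl => absurd (Finset.mem_Icc.mpr (by omega)) hl), if_pos (by omega)]
      congr 2; omega
    · exact Finset.sum_eq_zero fun l hl => if_neg (by have := Finset.mem_Icc.mp hl; omega)
  have h2 : (∑ l ∈ Finset.Icc 1 ((N - 1) / 2), if (i : ℕ) + 1 = 2 * l + 1 ∧ (j : ℕ) + 1 = 2 * l then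
      (a (2 * l) : ℂ) else 0) =
      if (j : ℕ) % 2 = 1 ∧ (i : ℕ) = j + 1 then (a (j + 1) : ℂ) else 0 := by
    split_ifs with h
    · rw [Finset.sum_eq_single (((j : ℕ) + 1) / 2) (fun l _ hl => if_neg (by omega))
        (fun hl => absurd (Finset.mem_Icc.mpr (by omega)) hl), if_pos (by omega)]
      congr 2; omega
    · exact Finset.sum_eq_zero fun l hl => if_neg (by have := Finset.mem_Icc.mp hl; omega)
  rw [h1, h2]
  split_ifs <;> first | omega | simp

theorem Amat_mul_eq_zero (a : ℕ → ℝ) (i j l : Fin N) : Amat N a i j * Amat N a j l = 0 := by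
  rw [Amat_apply, Amat_apply]
  split_ifs <;> first | omega | simp

theorem Amat_conj (a : ℕ → ℝ) (i j : Fin N) : starRingEnd ℂ (Amat N a i j) = Amat N a i j := by
  rw [Amat_apply, Complex.conj_ofReal]

theorem Amat_connected {a : ℕ → ℝ} (ha : ∀ j, 1 ≤ j → j ≤ N - 1 → a j ≠ 0) (i j : Fin N) :
    Relation.EqvGen (fun i j => Amat N a i j ≠ 0) i j := by
  have h0 : ∀ (k : ℕ) (hk : k < N), Relation.EqvGen (fun i j => Amat N a i j ≠ 0)
      ⟨0, by omega⟩ ⟨k, hk⟩ := fun k => by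
    induction k with
    | zero => exact fun hk => .refl _
    | succ k ih =>
      intro hk
      have hak : (a (k + 1) : ℂ) ≠ 0 := by exact_mod_cast ha (k + 1) (by omega) (by omega)
      refine .trans _ _ _ (ih (by omega)) ?_
      rcases Nat.mod_two_eq_zero_or_one k with h | h
      · refine .rel _ _ ?_
        rw [Amat_apply, if_pos (by simp; omega), if_pos rfl]
        exact hak
      · refine .symm _ _ (.rel _ _ ?_)
        rw [Amat_apply, if_pos (by simpa using h), if_neg (by simp; omega), if_pos rfl]
        exact hak
  exact .trans _ _ _ (.symm _ _ (h0 i i.2)) (h0 j j.2)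

theorem mval_mul_Tmat (a : ℕ → ℝ) (P : (Mat N)[X]) (x : ℝ) (s i : Fin N) :
    (mval P x * Tmat N a x) s i = (twist (Amat N a) (rows P s) i).eval (x : ℂ) := by
  rw [Tmat, mul_add, mul_one, Matrix.add_apply, mval_apply, Matrix.mul_smul, Matrix.smul_apply,
    Matrix.mul_apply, twist_apply, eval_add, eval_mul, eval_X, eval_finsetSum]
  simp only [mval_apply, eval_smul, smul_eq_mul, mul_comm]

theorem conj_mval_mul_Tmat (a : ℕ → ℝ) (P : (Mat N)[X]) (x : ℝ) (s i : Fin N) :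
    starRingEnd ℂ ((mval P x * Tmat N a x) s i) =
      (twist (Amat N a) (conjRows P s) i).eval (x : ℂ) := by
  have h : twist (Amat N a) (conjRows P s) i =
      (twist (Amat N a) (rows P s) i).map (starRingEnd ℂ) := by
    simp only [twist_apply, conjRows, Matrix.map_apply, Polynomial.map_add, Polynomial.map_mul,
      map_X, Polynomial.map_sum, Polynomial.map_smul, Amat_conj]
  rw [mval_mul_Tmat, h, ← Complex.conj_ofReal x, eval_map_apply, Complex.conj_ofReal]

theorem integral_WL {α : ℕ → ℝ} (hα : ∀ j, 1 ≤ j → j ≤ N → -1 < α j) (a : ℕ → ℝ)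
    (P Q : (Mat N)[X]) (s t : Fin N) :
    ∫ x in Set.Ioi (0 : ℝ), (mval P x * WL N a α x * (mval Q x)ᴴ) s t =
      pairing (fun i : Fin N => laguerreFunctional (α ((i : ℕ) + 1))) (Amat N a)
        (rows P s) (conjRows Q t) := by
  have hint := fun i : Fin N => integral_laguerre (hα ((i : ℕ) + 1) (by omega) (by omega))
    (twist (Amat N a) (rows P s) i * twist (Amat N a) (conjRows Q t) i)
  rw [pairing_apply, ← Finset.sum_congr rfl fun i _ => (hint i).2,
    ← integral_finsetSum _ fun i _ => (hint i).1]
  congr 1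
  funext x
  have : mval P x * WL N a α x * (mval Q x)ᴴ =
      (mval P x * Tmat N a x) * laguerreDiag N α x * (mval Q x * Tmat N a x)ᴴ := by
    simp only [WL, Matrix.conjTranspose_mul, mul_assoc]
  rw [this, Matrix.mul_apply]
  refine Finset.sum_congr rfl fun i _ => ?_
  rw [laguerreDiag, Matrix.mul_diagonal, Matrix.conjTranspose_apply, ← starRingEnd_apply,
    conj_mval_mul_Tmat, mval_mul_Tmat, eval_mul]
  ring

/-- The right action of a matrix differential operator on row vectors. -/
def rowOp (F : ℕ → (Mat N)[X]) (n : ℕ) : Module.End ℂ (Fin N → ℂ[X]) :=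
  ∑ r ∈ Finset.range (n + 1), LinearMap.pi fun j =>
    ∑ i, (mulOp (rows (F r) i j) * derivOp ^ r) ∘ₗ (LinearMap.proj i : (Fin N → ℂ[X]) →ₗ[ℂ] ℂ[X])

theorem rowOp_apply (F : ℕ → (Mat N)[X]) (n : ℕ) (u : Fin N → ℂ[X]) (j : Fin N) :
    rowOp F n u j =
      ∑ r ∈ Finset.range (n + 1), ∑ i, rows (F r) i j * (derivOp ^ r) (u i) := by
  simp [rowOp, LinearMap.sum_apply]

theorem entry_rowOp (F : ℕ → (Mat N)[X]) (n : ℕ) (i j : Fin N) :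
    entry (rowOp F n) i j =
      ∑ r ∈ Finset.range (n + 1), mulOp (rows (F r) i j) * derivOp ^ r := by
  refine LinearMap.ext fun f => ?_
  rw [entry_apply, rowOp_apply, LinearMap.sum_apply]
  refine Finset.sum_congr rfl fun r _ => ?_
  rw [Finset.sum_eq_single i (fun l _ hl => by simp [Pi.single_eq_of_ne hl]) (by simp)]
  simp

theorem isTame_entry_rowOp (F : ℕ → (Mat N)[X]) (n : ℕ) (i j : Fin N) :
    IsTame (entry (rowOp F n) i j) := by
  rw [entry_rowOp]
  refine IsTame.sum fun r _ => IsTame.mulOp_mul _ ?_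
  simpa using IsTame.one.mul_derivOp_pow r

theorem hasSymbol_entry_rowOp (F : ℕ → (Mat N)[X]) (n : ℕ) (i j : Fin N) :
    HasSymbol n (rows (F n) i j) (entry (rowOp F n) i j) := by
  have hd : ∀ r, HasSymbol r 1 (derivOp ^ r) := fun r => by
    induction r with
    | zero => exact HasSymbol.one
    | succ r ih => rw [pow_succ']; exact ih.derivOp_mul
  have h := fun r => (hd r).mulOp_mul (rows (F r) i j)
  simp only [mul_one] at h
  rw [entry_rowOp, Finset.sum_range_succ]
  have h' : HasSymbol n (∑ r ∈ Finset.range n, (0 : ℂ[X]))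
      (∑ r ∈ Finset.range n, mulOp (rows (F r) i j) * derivOp ^ r) :=
    HasSymbol.sum fun r hr => (h r).lift_of_lt (Finset.mem_range.mp hr)
  simpa using h'.add (h n)

theorem rowOp_rows (F : ℕ → (Mat N)[X]) (n : ℕ) (P : (Mat N)[X]) (s : Fin N) :
    rowOp F n (rows P s) = rows (applyOp F n P) s := by
  have hd : ∀ (r : ℕ) (i : Fin N),
      rows ((fun Q : (Mat N)[X] => derivative Q)^[r] P) s i = (derivOp ^ r) (rows P s i) :=
    fun r i => by
      induction r with
      | zero => rfl
      | succ r ih =>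
        rw [pow_succ', Module.End.mul_apply, ← ih, Function.iterate_succ_apply']
        ext k
        simp only [rows_coeff, coeff_derivative]
        rw [mul_add, mul_one, ← nsmul_eq_mul', Matrix.add_apply, Matrix.smul_apply, nsmul_eq_mul',
          mul_add, mul_one]
  funext j
  have hsum : rows (applyOp F n P) = ∑ r ∈ Finset.range (n + 1),
      rows ((fun Q : (Mat N)[X] => derivative Q)^[r] P) * rows (F r) := by
    simp only [rows, applyOp, map_sum, map_mul]
  rw [rowOp_apply, hsum, Matrix.sum_apply]
  refine Finset.sum_congr rfl fun r _ => ?_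
  rw [Matrix.mul_apply]
  exact Finset.sum_congr rfl fun i _ => by rw [hd, mul_comm]

theorem rows_C_mul (Λ : Mat N) (P : (Mat N)[X]) (s : Fin N) :
    rows (C Λ * P) s = ∑ t, Λ s t • rows P t := by
  funext i
  ext k
  simp [rows_coeff, Matrix.mul_apply, finsetSum_coeff]

end Concrete

/-- any differential operator (of order `n`, with nonzero leading coefficient
`F_n`) having the monic orthogonal polynomials of `W_L` as eigenfunctions has even order
`n = 2m`, and `F_n(x) = c xᵐ I` for some `c ∈ ℂ`. -/
theorem stmt9 (N : ℕ) (hN : 2 ≤ N) (a : ℕ → ℝ)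
    (ha : ∀ j, 1 ≤ j → j ≤ N - 1 → a j ≠ 0)
    (α : ℕ → ℝ)
    (hα : ∀ j, 1 ≤ j → j ≤ N → -1 < α j)
    (hαint : ∀ i j, 1 ≤ i → i ≤ N → 1 ≤ j → j ≤ N → i ≠ j →
      ¬ ∃ k : ℤ, α i - α j = (k : ℝ))
    (P : ℕ → Polynomial (Mat N))
    (hdeg : ∀ n, (P n).natDegree = n)
    (hmonic : ∀ n, (P n).Monic)
    (horth : ∀ n m, n ≠ m → ∀ s t : Fin N,
      ∫ x in Set.Ioi (0 : ℝ), (mval (P n) x * WL N a α x * (mval (P m) x)ᴴ) s t = 0)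
    (n : ℕ) (F : ℕ → Polynomial (Mat N)) (hFn : F n ≠ 0)
    (heig : ∀ k : ℕ, ∃ Λ : Mat N, applyOp F n (P k) = Polynomial.C Λ * P k) :
    ∃ m : ℕ, n = 2 * m ∧
      ∃ c : ℂ, F n = Polynomial.C (c • (1 : Mat N)) * Polynomial.X ^ m := by
  have hL := fun i : Fin N => isLaguerre_laguerreFunctional (hα ((i : ℕ) + 1) (by omega) (by omega))
  have hR := isMonicSeq_rows hdeg hmonic
  have hne : ∃ i j, rows (F n) i j ≠ 0 := by
    by_contra! h
    have : rows (F n) = 0 := by ext1 i j; exact h i j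
    exact hFn (by simpa [rows] using this)
  obtain ⟨m, hm, c, hc⟩ := exists_leading_coeff hL
    (fun i j hij => hαint _ _ (by omega) (by omega) (by omega) (by omega) (by omega))
    (Amat_mul_eq_zero a) (Amat_connected ha) hR (isMonicSeq_conjRows hR)
    (fun k m hkm s t => by rw [← integral_WL hα, horth k m hkm]) (isTame_entry_rowOp F n)
    (fun k s => by
      obtain ⟨Λ, hΛ⟩ := heig k
      rw [rowOp_rows, hΛ, rows_C_mul]
      exact Submodule.sum_mem _ fun t _ =>
        Submodule.smul_mem _ _ (Submodule.subset_span ⟨t, rfl⟩))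
    (hasSymbol_entry_rowOp F n) hne
  refine ⟨m, hm, c, ?_⟩
  ext k i j
  rw [← rows_coeff, hc, coeff_C_mul, coeff_X_pow]
  split_ifs with h1 h2 h2 <;> simp [h1, h2, coeff_X_pow]
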